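/- Let X_1, X_2, ... satisfy Assumption 1 and Assumption 2 with common conditional variance V := Var((X_i − μ)²) strictly positive, and let (δ_n)_{n≥1} be deterministic with δ_n > 0 and δ_n → δ > 0. With λ_{t,δ_n} := min( sqrt( 2 log(1/δ_n)/( m̂²_{4,t} · n ) ), c_1 ), where c_1 ∈ (0,1] and m̂²_{4,t} is the fourth-moment estimator of the context with c_2 > 0, it holds that (1/√n) Σ_{i=1}^n λ_{i,δ_n} → sqrt( 2 log(1/δ) / V ) almost surely as n → ∞. -/

import Mathlib

open MeasureTheory ProbabilityTheory Filter Finset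

variable {Ω : Type*}

/-- `μ̂_t := (c₄ + Σ_{i≤t−1} X_i)/t`. -/
noncomputable def muHat (c4 : ℝ) (X : ℕ → Ω → ℝ) (t : ℕ) (ω : Ω) : ℝ :=
  (c4 + ∑ i ∈ Finset.Icc 1 (t-1), X i ω) / (t : ℝ)

/-- `σ̂_t² := (c₃ + Σ_{i≤t−1}(X_i − μ̂_i)²)/t`. -/
noncomputable def sigHat2 (c3 c4 : ℝ) (X : ℕ → Ω → ℝ) (t : ℕ) (ω : Ω) : ℝ :=
  (c3 + ∑ i ∈ Finset.Icc 1 (t-1), (X i ω - muHat c4 X i ω)^2) / (t : ℝ)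

/-- `m̂²_{4,t} := (c₂ + Σ_{i≤t−1} [(X_i − μ̂_i)² − σ̂_i²]²)/t`. -/
noncomputable def m4Hat2 (c2 c3 c4 : ℝ) (X : ℕ → Ω → ℝ) (t : ℕ) (ω : Ω) : ℝ :=
  (c2 + ∑ i ∈ Finset.Icc 1 (t-1),
      ((X i ω - muHat c4 X i ω)^2 - sigHat2 c3 c4 X i ω)^2) / (t : ℝ)

/-- Batch plug-in `λ_{i,d} := min(√(2 log(1/d)/(m̂²_{4,i} n)), c₁)`. -/
noncomputable def lamB (c1 c2 c3 c4 : ℝ) (X : ℕ → Ω → ℝ) (d : ℝ) (n i : ℕ) (ω : Ω) : ℝ :=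
  min (Real.sqrt (2 * Real.log (1/d) / (m4Hat2 c2 c3 c4 X i ω * (n : ℝ)))) c1

theorem aux_sum_Icc (f : ℕ → ℝ) (n : ℕ) :
    ∑ i ∈ Finset.Icc 1 n, f i = ∑ i ∈ Finset.range n, f (i+1) := by
  induction n with
  | zero => simp
  | succ n ih => rw [Finset.sum_Icc_succ_top (by omega), ih, Finset.sum_range_succ]

/-- Kronecker's lemma for weights `i+1`. -/
theorem aux_kronecker (d : ℕ → ℝ) (c : ℝ)
    (h : Tendsto (fun n : ℕ => ∑ i ∈ Finset.range n, d i / ((i:ℝ)+1)) atTop (nhds c)) :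
    Tendsto (fun n : ℕ => (n:ℝ)⁻¹ * ∑ i ∈ Finset.range n, d i) atTop (nhds 0) := by
  set S : ℕ → ℝ := fun n => ∑ i ∈ Finset.range n, d i / ((i:ℝ)+1) with hS
  have key : ∀ n : ℕ, ∑ i ∈ Finset.range n, d i = n * S n - ∑ i ∈ Finset.range n, S i := by
    intro n
    induction n with
    | zero => simp
    | succ n ih =>
      have h1 : S (n+1) = S n + d n / ((n:ℝ)+1) := by simp [hS, Finset.sum_range_succ]
      rw [Finset.sum_range_succ, Finset.sum_range_succ, ih, h1]
      have : ((n:ℝ)+1) ≠ 0 := by positivity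
      push_cast
      field_simp
      ring
  have h2 := h.sub h.cesaro
  rw [sub_self] at h2
  refine h2.congr' ?_
  filter_upwards [eventually_gt_atTop 0] with n hn
  have : (n:ℝ) ≠ 0 := by positivity
  rw [key n]
  field_simp

/-- Strong law for bounded martingale differences. -/
theorem aux_slln {m0 : MeasurableSpace Ω} (P : Measure Ω) [IsProbabilityMeasure P]
    (ℱ : Filtration ℕ m0) (d : ℕ → Ω → ℝ) (C : ℝ)
    (hmeas : ∀ i, Measurable[ℱ (i+1)] (d i))
    (hbd : ∀ i, ∀ᵐ ω ∂P, |d i ω| ≤ C)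
    (hce : ∀ i, P[d i|ℱ i] =ᵐ[P] 0) :
    ∀ᵐ ω ∂P, Tendsto (fun n : ℕ => (n:ℝ)⁻¹ * ∑ i ∈ Finset.range n, d i ω) atTop (nhds 0) := by
  set M : ℕ → Ω → ℝ := fun n ω => ∑ i ∈ Finset.range n, d i ω / ((i:ℝ)+1) with hM
  have hMadp : ∀ n, Measurable[ℱ n] (M n) := by
    intro n
    refine Finset.measurable_fun_sum _ fun i hi => ?_
    have : Measurable[ℱ n] (d i) :=
      (hmeas i).mono (ℱ.mono (by simpa using hi)) le_rfl
    exact this.div_const _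
  have hMsm : StronglyAdapted ℱ M := fun n => (hMadp n).stronglyMeasurable
  have hall : ∀ᵐ ω ∂P, ∀ i, |d i ω| ≤ C := ae_all_iff.2 hbd
  have hMbd : ∀ n, ∀ᵐ ω ∂P, ‖M n ω‖ ≤ ∑ i ∈ Finset.range n, C / ((i:ℝ)+1) := by
    intro n
    filter_upwards [hall] with ω hω
    refine (norm_sum_le _ _).trans (Finset.sum_le_sum fun i _ => ?_)
    rw [Real.norm_eq_abs, abs_div, abs_of_pos (show (0:ℝ) < (i:ℝ)+1 by positivity)]
    gcongr
    exact hω i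
  have hMmeas : ∀ n, Measurable (M n) := fun n => (hMadp n).mono (ℱ.le n) le_rfl
  have hdmeas : ∀ n, Measurable (d n) := fun n => (hmeas n).mono (ℱ.le _) le_rfl
  have hMint : ∀ n, Integrable (M n) P := fun n =>
    Integrable.of_bound (hMmeas n).aestronglyMeasurable _ (hMbd n)
  have hdint : ∀ n, Integrable (d n) P := fun n =>
    Integrable.of_bound (hdmeas n).aestronglyMeasurable C (hbd n)
  have hMdint : ∀ n, Integrable (M n * d n) P := fun n =>
    (hdint n).bdd_mul (hMmeas n).aestronglyMeasurable (hMbd n)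
  have hMMint : ∀ n, Integrable (M n * M n) P := fun n =>
    (hMint n).bdd_mul (hMmeas n).aestronglyMeasurable (hMbd n)
  have hddint : ∀ n, Integrable (d n * d n) P := fun n =>
    (hdint n).bdd_mul (hdmeas n).aestronglyMeasurable (hbd n)
  have hsucc : ∀ n ω, M (n+1) ω = M n ω + ((n:ℝ)+1)⁻¹ * d n ω := by
    intro n ω
    simp only [hM, Finset.sum_range_succ]
    ring
  have hmart : Martingale M ℱ P := by
    refine martingale_of_condExp_sub_eq_zero_nat hMsm hMint fun i => ?_
    have : M (i+1) - M i = ((i:ℝ)+1)⁻¹ • d i := by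
      ext ω
      simp [hsucc]
    rw [this]
    refine (condExp_smul _ _ _).trans ?_
    filter_upwards [hce i] with ω hω
    simp [hω]
  have horth : ∀ n, ∫ ω, (M n * d n) ω ∂P = 0 := by
    intro n
    rw [← integral_condExp (ℱ.le n)]
    have h1 := condExp_mul_of_stronglyMeasurable_left (μ := P) (hMsm n) (hMdint n) (hdint n)
    have h2 : P[M n * d n|ℱ n] =ᵐ[P] 0 := by
      filter_upwards [h1, hce n] with ω h1 h2
      rw [h1]
      simp [h2]
    rw [integral_congr_ae h2]
    simp
  have hdd : ∀ n, ∫ ω, (d n * d n) ω ∂P ≤ C^2 := by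
    intro n
    have : ∫ ω, (d n * d n) ω ∂P ≤ ∫ _, C^2 ∂P := by
      refine integral_mono_ae (hddint n) (integrable_const _) ?_
      filter_upwards [hbd n] with ω hω
      have := sq_le_sq' (by linarith [neg_abs_le (d n ω)]) ((le_abs_self _).trans hω)
      simpa [sq] using this
    simpa using this
  have hsq : ∀ n, ∫ ω, (M n * M n) ω ∂P ≤ C^2 * ∑ i ∈ Finset.range n, (((i:ℝ)+1)^2)⁻¹ := by
    intro n
    induction n with
    | zero => simp [hM]
    | succ n ih =>
      have e : M (n+1) * M (n+1) = fun ω => ((M n * M n) ω + (2 * ((n:ℝ)+1)⁻¹) * (M n * d n) ω)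
          + (((n:ℝ)+1)^2)⁻¹ * (d n * d n) ω := by
        ext ω
        simp only [Pi.mul_apply, hsucc]
        field_simp
        ring
      have hi1 : Integrable (fun ω => (M n * M n) ω + (2 * ((n:ℝ)+1)⁻¹) * (M n * d n) ω) P :=
        (hMMint n).add ((hMdint n).const_mul _)
      rw [e, integral_add hi1 ((hddint n).const_mul _),
        integral_add (hMMint n) ((hMdint n).const_mul _), integral_const_mul, integral_const_mul,
        horth, Finset.sum_range_succ, mul_add]
      have h3 : (((n:ℝ)+1)^2)⁻¹ * ∫ ω, (d n * d n) ω ∂P ≤ (((n:ℝ)+1)^2)⁻¹ * C^2 := by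
        gcongr
        exact hdd n
      linarith
  have hsum : Summable (fun i : ℕ => (((i:ℝ)+1)^2)⁻¹) := by
    have := (summable_nat_add_iff 1).2 (Real.summable_nat_pow_inv.2 (show 1 < 2 by norm_num))
    simpa using this
  set R : ℝ := 1 + C^2 * ∑' i : ℕ, (((i:ℝ)+1)^2)⁻¹ with hR
  have hL1 : ∀ n, eLpNorm (M n) 1 P ≤ (R.toNNReal : ENNReal) := by
    intro n
    rw [eLpNorm_one_eq_lintegral_enorm, ← ofReal_integral_norm_eq_lintegral_enorm (hMint n)]
    refine ENNReal.ofReal_le_ofReal ?_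
    have h1 : ∫ ω, ‖M n ω‖ ∂P ≤ ∫ ω, (1 + (M n * M n) ω) ∂P := by
      refine integral_mono (hMint n).norm ((integrable_const _).add (hMMint n)) fun ω => ?_
      simp only [Pi.mul_apply, Real.norm_eq_abs]
      nlinarith [sq_nonneg (|M n ω| - 1), sq_abs (M n ω), sq_nonneg (M n ω)]
    rw [integral_add (integrable_const _) (hMMint n)] at h1
    simp only [integral_const, probReal_univ, smul_eq_mul, mul_one] at h1
    have h2 : C^2 * ∑ i ∈ Finset.range n, (((i:ℝ)+1)^2)⁻¹ ≤ C^2 * ∑' i : ℕ, (((i:ℝ)+1)^2)⁻¹ := by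
      gcongr
      exact hsum.sum_le_tsum _ (fun i _ => by positivity)
    linarith [hsq n]
  filter_upwards [hmart.submartingale.exists_ae_tendsto_of_bdd hL1] with ω ⟨c, hc⟩
  exact aux_kronecker (fun i => d i ω) c hc

/-- version with a mean -/
theorem aux_slln' {m0 : MeasurableSpace Ω} (P : Measure Ω) [IsProbabilityMeasure P]
    (ℱ : Filtration ℕ m0) (Y : ℕ → Ω → ℝ) (C L : ℝ)
    (hmeas : ∀ i, Measurable[ℱ i] (Y i))
    (hbd : ∀ i, 1 ≤ i → ∀ᵐ ω ∂P, |Y i ω| ≤ C)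
    (hce : ∀ i, 1 ≤ i → P[Y i|ℱ (i-1)] =ᵐ[P] fun _ => L) :
    ∀ᵐ ω ∂P, Tendsto (fun n : ℕ => (n:ℝ)⁻¹ * ∑ i ∈ Finset.range n, Y (i+1) ω)
      atTop (nhds L) := by
  have hYint : ∀ i, Integrable (Y (i+1)) P := fun i =>
    Integrable.of_bound ((hmeas (i+1)).mono (ℱ.le _) le_rfl).aestronglyMeasurable C
      (hbd (i+1) (by omega))
  have h := aux_slln P ℱ (fun i => Y (i+1) - fun _ => L) (C + |L|)
    (fun i => (hmeas (i+1)).sub measurable_const)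
    (fun i => by
      filter_upwards [hbd (i+1) (by omega)] with ω hω
      exact (abs_sub _ _).trans (by linarith))
    (fun i => by
      refine (condExp_sub (hYint i) (integrable_const L) _).trans ?_
      filter_upwards [hce (i+1) (by omega)] with ω hω
      rw [Nat.add_sub_cancel] at hω
      simp [hω, condExp_const (ℱ.le i)])
  filter_upwards [h] with ω hω
  have h2 := hω.add_const L
  rw [zero_add] at h2
  refine h2.congr' ?_
  filter_upwards [eventually_gt_atTop 0] with n hn
  have : (n:ℝ) ≠ 0 := by positivity
  simp only [Pi.sub_apply, Finset.sum_sub_distrib, Finset.sum_const, Finset.card_range,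
    nsmul_eq_mul]
  field_simp
  ring

theorem aux_avg (a b : ℕ → ℝ) (c L : ℝ)
    (ha : Tendsto (fun n : ℕ => (n:ℝ)⁻¹ * ∑ i ∈ Finset.range n, a (i+1)) atTop (nhds L))
    (hab : Tendsto (fun i => b i - a i) atTop (nhds 0)) :
    Tendsto (fun t : ℕ => (c + ∑ i ∈ Finset.Icc 1 (t-1), b i) / (t:ℝ)) atTop (nhds L) := by
  rw [← tendsto_add_atTop_iff_nat 1]
  have h1 := ((tendsto_add_atTop_iff_nat 1).2 hab).cesaro
  have h2 := h1.add ha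
  have h3 := tendsto_natCast_div_add_atTop (1:ℝ)
  have h4 : Tendsto (fun n : ℕ => c / ((n:ℝ)+1)) atTop (nhds 0) :=
    tendsto_const_nhds.div_atTop (tendsto_atTop_add_const_right _ _ tendsto_natCast_atTop_atTop)
  have h5 := h4.add (h3.mul h2)
  simp only [zero_add, one_mul] at h5
  refine h5.congr' ?_
  filter_upwards [eventually_gt_atTop 0] with n hn
  have : (n:ℝ) ≠ 0 := by positivity
  rw [Nat.add_sub_cancel, aux_sum_Icc, Finset.sum_sub_distrib]
  push_cast
  field_simp
  ring

theorem aux_final (m : ℕ → ℝ) (V c1 l : ℝ) (L : ℕ → ℝ) (hc1 : 0 < c1) (hV : 0 < V)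
    (hm : ∀ i, 1 ≤ i → 0 < m i) (hmV : Tendsto m atTop (nhds V))
    (hL : Tendsto L atTop (nhds l)) :
    Tendsto (fun n : ℕ => (1 / Real.sqrt n) *
      ∑ i ∈ Finset.Icc 1 n, min (Real.sqrt (L n / (m i * (n:ℝ)))) c1) atTop
      (nhds (Real.sqrt (l / V))) := by
  have h1 : Tendsto (fun i => (m (i+1))⁻¹) atTop (nhds V⁻¹) :=
    ((tendsto_add_atTop_iff_nat 1).2 hmV).inv₀ hV.ne'
  obtain ⟨B, hB⟩ := h1.bddAbove_range
  have hB' : ∀ i, 1 ≤ i → (m i)⁻¹ ≤ B := by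
    intro i hi
    obtain ⟨j, rfl⟩ : ∃ j, i = j + 1 := ⟨i-1, by omega⟩
    exact hB ⟨j, rfl⟩
  have h2 : Tendsto (fun n : ℕ => |L n| * B / (n:ℝ)) atTop (nhds 0) :=
    (hL.abs.mul_const B).div_atTop tendsto_natCast_atTop_atTop
  have h3 : ∀ᶠ n : ℕ in atTop, |L n| * B / (n:ℝ) < c1^2 :=
    h2.eventually_lt_const (by positivity)
  have h4 : Tendsto (fun i => (Real.sqrt (m (i+1)))⁻¹) atTop (nhds (Real.sqrt V)⁻¹) :=
    ((tendsto_add_atTop_iff_nat 1).2 hmV).sqrt.inv₀ (Real.sqrt_pos.2 hV).ne'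
  have h5 := hL.sqrt.mul h4.cesaro
  rw [Real.sqrt_div' _ hV.le, div_eq_mul_inv]
  refine h5.congr' ?_
  filter_upwards [h3, eventually_gt_atTop 0] with n hn hn0
  have hn' : (0:ℝ) < n := by positivity
  have e : ∀ i ∈ Finset.Icc 1 n, min (Real.sqrt (L n / (m i * (n:ℝ)))) c1 =
      Real.sqrt (L n) * (Real.sqrt n)⁻¹ * (Real.sqrt (m i))⁻¹ := by
    intro i hi
    have hi1 : 1 ≤ i := (Finset.mem_Icc.1 hi).1
    rw [min_eq_left, Real.sqrt_div' _ (mul_pos (hm i hi1) hn').le, Real.sqrt_mul (hm i hi1).le,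
      div_eq_mul_inv, mul_inv]
    · ring
    · refine (Real.sqrt_le_left hc1.le).2 (le_trans ?_ hn.le)
      calc L n / (m i * n) = L n * (m i)⁻¹ / n := by
            have := (hm i hi1).ne'
            field_simp
        _ ≤ |L n| * B / n := by
            have := (hm i hi1)
            gcongr
            · exact le_abs_self _
            · exact hB' i hi1
  rw [Finset.sum_congr rfl e, ← Finset.mul_sum, aux_sum_Icc (fun i => (Real.sqrt (m i))⁻¹)]
  have h6 : (n:ℝ)⁻¹ = (Real.sqrt n)⁻¹ * (Real.sqrt n)⁻¹ := by
    rw [← mul_inv, Real.mul_self_sqrt hn'.le]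
  rw [h6]
  ring

/-- Proposition 19 of the paper: when `V > 0`,
`(1/√n) Σ_{i=1}^n λ_{i,δ_n} → √(2 log(1/δ)/V)` almost surely. -/
theorem sum_lambda_rescaled_converges
    {m0 : MeasurableSpace Ω} (P : Measure Ω) [IsProbabilityMeasure P]
    (ℱ : Filtration ℕ m0) (X : ℕ → Ω → ℝ) (μ σ2 V δ : ℝ) (δseq : ℕ → ℝ)
    (c1 c2 c3 c4 : ℝ)
    (hc1 : c1 ∈ Set.Ioc (0:ℝ) 1) (hc2 : c2 ∈ Set.Ioc (0:ℝ) 1)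
    (hc3 : c3 ∈ Set.Ioc (0:ℝ) 1) (hc4 : c4 ∈ Set.Icc (0:ℝ) 1)
    (hadapt : Adapted ℱ X)
    (hint : ∀ t, 1 ≤ t → Integrable (X t) P)
    (hbdd : ∀ t, 1 ≤ t → ∀ᵐ ω ∂P, X t ω ∈ Set.Icc (0:ℝ) 1)
    (hmean : ∀ t, 1 ≤ t → P[X t|ℱ (t - 1)] =ᵐ[P] fun _ => μ)
    (hvar : ∀ t, 1 ≤ t → P[(fun ω => (X t ω - μ)^2)|ℱ (t - 1)] =ᵐ[P] fun _ => σ2)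
    (hvar4 : ∀ t, 1 ≤ t →
      P[(fun ω => ((X t ω - μ)^2 - σ2)^2)|ℱ (t - 1)] =ᵐ[P] fun _ => V)
    (hV : 0 < V)
    (hδpos : ∀ n, 0 < δseq n) (hδlim : Tendsto δseq atTop (nhds δ)) (hδ : 0 < δ) :
    ∀ᵐ ω ∂P, Tendsto
      (fun n : ℕ => (1 / Real.sqrt n) * ∑ i ∈ Finset.Icc 1 n, lamB c1 c2 c3 c4 X (δseq n) n i ω)
      atTop (nhds (Real.sqrt (2 * Real.log (1/δ) / V))) := by
  have hXm : ∀ i, Measurable[ℱ i] (X i) := hadapt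
  have hm2 : ∀ i, Measurable[ℱ i] (fun ω => (X i ω - μ)^2) := fun i =>
    ((hXm i).sub_const _).pow_const 2
  have hm4 : ∀ i, Measurable[ℱ i] (fun ω => ((X i ω - μ)^2 - σ2)^2) := fun i =>
    ((hm2 i).sub_const _).pow_const 2
  have b1 : ∀ x : ℝ, x ∈ Set.Icc (0:ℝ) 1 → |x - μ| ≤ 1 + |μ| := by
    intro x hx
    refine (abs_sub _ _).trans ?_
    rw [abs_of_nonneg hx.1]
    linarith [hx.2]
  have b2 : ∀ x : ℝ, x ∈ Set.Icc (0:ℝ) 1 → |(x - μ)^2| ≤ (1 + |μ|)^2 := by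
    intro x hx
    rw [abs_pow]
    exact pow_le_pow_left₀ (abs_nonneg _) (b1 x hx) 2
  have b4 : ∀ x : ℝ, x ∈ Set.Icc (0:ℝ) 1 → |((x - μ)^2 - σ2)^2| ≤ ((1 + |μ|)^2 + |σ2|)^2 := by
    intro x hx
    rw [abs_pow]
    refine pow_le_pow_left₀ (abs_nonneg _) ((abs_sub _ _).trans ?_) 2
    linarith [b2 x hx]
  have s1 := aux_slln' P ℱ X 1 μ hXm (fun i hi => by
    filter_upwards [hbdd i hi] with ω hω
    rw [abs_of_nonneg hω.1]
    exact hω.2) hmean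
  have s2 := aux_slln' P ℱ (fun i ω => (X i ω - μ)^2) _ σ2 hm2 (fun i hi => by
    filter_upwards [hbdd i hi] with ω hω
    exact b2 _ hω) hvar
  have s4 := aux_slln' P ℱ (fun i ω => ((X i ω - μ)^2 - σ2)^2) _ V hm4 (fun i hi => by
    filter_upwards [hbdd i hi] with ω hω
    exact b4 _ hω) hvar4
  have hball : ∀ᵐ ω ∂P, ∀ t, 1 ≤ t → X t ω ∈ Set.Icc (0:ℝ) 1 := by
    rw [ae_all_iff]
    intro t
    by_cases ht : 1 ≤ t
    · filter_upwards [hbdd t ht] with ω hω _ using hω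
    · exact ae_of_all _ fun ω h => absurd h ht
  filter_upwards [s1, s2, s4, hball] with ω s1 s2 s4 hb
  have t1 : Tendsto (fun t => muHat c4 X t ω) atTop (nhds μ) :=
    aux_avg (fun i => X i ω) (fun i => X i ω) c4 μ s1 (by simp)
  have d1 : Tendsto (fun t => μ - muHat c4 X t ω) atTop (nhds 0) := by
    simpa using t1.const_sub μ
  have d2 : Tendsto (fun i => (X i ω - muHat c4 X i ω)^2 - (X i ω - μ)^2) atTop (nhds 0) := by
    have hbd : IsBoundedUnder (· ≤ ·) atTop (norm ∘ fun i => 2 * (X i ω - μ)) := by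
      refine isBoundedUnder_of_eventually_le (a := 2 * (1 + |μ|)) ?_
      filter_upwards [eventually_ge_atTop 1] with i hi
      simp only [Function.comp, norm_mul, Real.norm_eq_abs]
      rw [abs_of_pos (by norm_num : (0:ℝ) < 2)]
      linarith [b1 _ (hb i hi)]
    have h := (d1.zero_mul_isBoundedUnder_le hbd).add (d1.pow 2)
    refine (h.congr fun i => ?_).trans (by simp)
    ring
  have t2 : Tendsto (fun t => sigHat2 c3 c4 X t ω) atTop (nhds σ2) :=
    aux_avg (fun i => (X i ω - μ)^2) (fun i => (X i ω - muHat c4 X i ω)^2) c3 σ2 s2 d2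
  have d3 : Tendsto (fun i => ((X i ω - muHat c4 X i ω)^2 - (X i ω - μ)^2)
      + (σ2 - sigHat2 c3 c4 X i ω)) atTop (nhds 0) := by
    simpa using d2.add (t2.const_sub σ2)
  have d4 : Tendsto (fun i => ((X i ω - muHat c4 X i ω)^2 - sigHat2 c3 c4 X i ω)^2
      - ((X i ω - μ)^2 - σ2)^2) atTop (nhds 0) := by
    have hbd : IsBoundedUnder (· ≤ ·) atTop (norm ∘ fun i => 2 * ((X i ω - μ)^2 - σ2)) := by
      refine isBoundedUnder_of_eventually_le (a := 2 * ((1 + |μ|)^2 + |σ2|)) ?_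
      filter_upwards [eventually_ge_atTop 1] with i hi
      simp only [Function.comp, norm_mul, Real.norm_eq_abs]
      rw [abs_of_pos (by norm_num : (0:ℝ) < 2)]
      have := abs_sub ((X i ω - μ)^2) σ2
      linarith [b2 _ (hb i hi)]
    have h := (d3.zero_mul_isBoundedUnder_le hbd).add (d3.pow 2)
    refine (h.congr fun i => ?_).trans (by simp)
    ring
  have t4 : Tendsto (fun t => m4Hat2 c2 c3 c4 X t ω) atTop (nhds V) :=
    aux_avg (fun i => ((X i ω - μ)^2 - σ2)^2)
      (fun i => ((X i ω - muHat c4 X i ω)^2 - sigHat2 c3 c4 X i ω)^2) c2 V s4 d4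
  have hpos : ∀ i, 1 ≤ i → 0 < m4Hat2 c2 c3 c4 X i ω := by
    intro i hi
    have h1 : 0 ≤ ∑ j ∈ Finset.Icc 1 (i-1),
      ((X j ω - muHat c4 X j ω)^2 - sigHat2 c3 c4 X j ω)^2 :=
      Finset.sum_nonneg fun j _ => sq_nonneg _
    have h2 : (0:ℝ) < i := by exact_mod_cast hi
    have h3 := hc2.1
    unfold m4Hat2
    positivity
  have hlog : Tendsto (fun n => 2 * Real.log (1 / δseq n)) atTop
      (nhds (2 * Real.log (1 / δ))) := by
    refine Tendsto.const_mul 2 (Tendsto.log ?_ (by positivity))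
    exact tendsto_const_nhds.div hδlim hδ.ne'
  exact aux_final (fun i => m4Hat2 c2 c3 c4 X i ω) V c1 _ _ hc1.1 hV hpos t4 hlog
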